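/- arXiv:1010.5081 — 3 statements merged into one kernel-verified Lean document; each statement's English description precedes it below -/
import Mathlib

section
/- In every Fair Value game and for every α ≥ 0, the α-price of anarchy with respect to the total profit is at most 2 + α: if a state S : N → M is an α-Nash equilibrium, i.e., (1+α)·u_i(S) ≥ u_i(S_{-i}, k) for every player i and every party k ∈ M, then tp(S') ≤ (2+α)·tp(S) for every state S' : N → M. -/
/-- The set of players affiliated with party `j` in state `S`. -/
def Qset {n m : ℕ} (S : Fin n → Fin m) (j : Fin m) : Finset (Fin n) :=
  Finset.univ.filter fun i => S i = j

/-- Total profit of a state: `tp(S) = ∑_{j∈M} v_j(Q_j(S))`. -/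
def totalProfit {n m : ℕ} (v : Fin m → Finset (Fin n) → ℝ) (S : Fin n → Fin m) : ℝ :=
  ∑ j, v j (Qset S j)

/-- Fair Value payoff: player `i`'s marginal contribution to his own party,
`u_i(S) = v_{S(i)}(Q_{S(i)}(S)) − v_{S(i)}(Q_{S(i)}(S) \ {i})`. -/
def fvPayoff {n m : ℕ} (v : Fin m → Finset (Fin n) → ℝ) (S : Fin n → Fin m)
    (i : Fin n) : ℝ :=
  v (S i) (Qset S (S i)) - v (S i) (Qset S (S i) \ {i})

/-- Joining `B` to `A` adds at most the sum of the marginal values over `A`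
of the elements of `B`. -/
theorem submodular_union_le {ι : Type*} [DecidableEq ι] (f : Finset ι → ℝ)
    (hmono : ∀ I J : Finset ι, I ⊆ J → f I ≤ f J)
    (hsub : ∀ I J : Finset ι, I ⊆ J → ∀ i ∉ J, f (insert i I) - f I ≥ f (insert i J) - f J)
    (A B : Finset ι) : f (A ∪ B) ≤ f A + ∑ i ∈ B, (f (insert i A) - f A) := by
  induction B using Finset.induction_on with
  | empty => simp
  | insert a B ha ih =>
    rw [Finset.sum_insert ha, Finset.union_insert]
    by_cases h : a ∈ A ∪ B
    · rw [Finset.insert_eq_of_mem h]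
      linarith [hmono A (insert a A) (Finset.subset_insert a A)]
    · linarith [hsub A (A ∪ B) Finset.subset_union_left a h]

/-- The marginal contributions to `C` of the members of a subset `B` sum to at most the value
of `B`. -/
theorem submodular_sum_marginal_le {ι : Type*} [DecidableEq ι] (f : Finset ι → ℝ)
    (hsub : ∀ I J : Finset ι, I ⊆ J → ∀ i ∉ J, f (insert i I) - f I ≥ f (insert i J) - f J)
    (B C : Finset ι) (hBC : B ⊆ C) : ∑ i ∈ B, (f C - f (C \ {i})) ≤ f B - f ∅ := by
  induction B using Finset.induction_on with
  | empty => simp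
  | insert a B ha ih =>
    rw [Finset.insert_subset_iff] at hBC
    have hB : B ⊆ C \ {a} := by
      rw [Finset.sdiff_singleton_eq_erase]
      exact Finset.subset_erase.2 ⟨hBC.2, ha⟩
    have h := hsub B (C \ {a}) hB a (by simp)
    rw [Finset.sdiff_singleton_eq_erase, Finset.insert_erase hBC.1] at h
    rw [Finset.sum_insert ha, Finset.sdiff_singleton_eq_erase]
    linarith [ih hBC.2]

/-- Grouping a sum over players by their parties. -/
theorem sum_Qset {n m : ℕ} (S : Fin n → Fin m) (g : Fin m → Fin n → ℝ) :
    ∑ j, ∑ i ∈ Qset S j, g j i = ∑ i, g (S i) i := by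
  rw [← Finset.sum_fiberwise Finset.univ S fun i => g (S i) i]
  refine Finset.sum_congr rfl fun j _ => Finset.sum_congr rfl fun i hi => ?_
  rw [(Finset.mem_filter.1 hi).2]

/-- A player who moves to a new party earns his marginal value over that party. -/
theorem fvPayoff_update {n m : ℕ} (v : Fin m → Finset (Fin n) → ℝ) (S : Fin n → Fin m)
    (i : Fin n) (k : Fin m) (h : S i ≠ k) :
    fvPayoff v (Function.update S i k) i = v k (insert i (Qset S k)) - v k (Qset S k) := by
  have hQ : Qset (Function.update S i k) k = insert i (Qset S k) := by
    ext a
    by_cases ha : a = i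
    · simp [Qset, ha]
    · simp [Qset, ha]
  have hi : i ∉ Qset S k := by simpa [Qset] using h
  rw [fvPayoff, Function.update_self, hQ, Finset.sdiff_singleton_eq_erase,
    Finset.erase_insert hi]

/-- In every Fair Value game and every `α ≥ 0`, the α-price of
anarchy with respect to the total profit is at most `2 + α`: if `S` is an
α-Nash equilibrium then `tp(S') ≤ (2+α)·tp(S)` for every state `S'`. -/
theorem fairValue_alpha_poa {n m : ℕ}
    (v : Fin m → Finset (Fin n) → ℝ)
    (hzero : ∀ j, v j ∅ = 0)
    (hmono : ∀ j (I J : Finset (Fin n)), I ⊆ J → v j I ≤ v j J)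
    (hsub : ∀ j (I J : Finset (Fin n)), I ⊆ J → ∀ i ∉ J,
      v j (insert i I) - v j I ≥ v j (insert i J) - v j J)
    (α : ℝ) (hα : 0 ≤ α)
    (S : Fin n → Fin m)
    (hNE : ∀ (i : Fin n) (k : Fin m),
      (1 + α) * fvPayoff v S i ≥ fvPayoff v (Function.update S i k) i) :
    ∀ S' : Fin n → Fin m, totalProfit v S' ≤ (2 + α) * totalProfit v S := by
  intro S'
  have hpay : ∀ i k, v k (insert i (Qset S k)) - v k (Qset S k) ≤ (1 + α) * fvPayoff v S i := by
    intro i k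
    by_cases h : S i = k
    · have hi : i ∈ Qset S k := by simpa [Qset] using h
      rw [Finset.insert_eq_of_mem hi, sub_self]
      exact mul_nonneg (by linarith) (sub_nonneg.2 (hmono _ _ _ Finset.sdiff_subset))
    · rw [← fvPayoff_update v S i k h]
      exact hNE i k
  have hsum : ∑ i, fvPayoff v S i ≤ totalProfit v S := by
    unfold fvPayoff totalProfit
    rw [← sum_Qset S fun j i => v j (Qset S j) - v j (Qset S j \ {i})]
    refine Finset.sum_le_sum fun j _ => ?_
    have h := submodular_sum_marginal_le (v j) (hsub j) (Qset S j) _ subset_rfl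
    rwa [hzero, sub_zero] at h
  have hS' : totalProfit v S' ≤ totalProfit v S + (1 + α) * ∑ i, fvPayoff v S i := by
    rw [Finset.mul_sum, ← sum_Qset S' fun _ i => (1 + α) * fvPayoff v S i]
    unfold totalProfit
    rw [← Finset.sum_add_distrib]
    refine Finset.sum_le_sum fun j _ => ?_
    calc v j (Qset S' j) ≤ v j (Qset S j ∪ Qset S' j) := hmono _ _ _ Finset.subset_union_right
      _ ≤ _ := submodular_union_le (v j) (hmono j) (hsub j) _ _
      _ ≤ _ := add_le_add_right (Finset.sum_le_sum fun i _ => hpay i j) _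
  calc totalProfit v S' ≤ _ := hS'
    _ ≤ totalProfit v S + (1 + α) * totalProfit v S := by gcongr
    _ = (2 + α) * totalProfit v S := by ring
end

section
/- In every Fair Value game, the price of stability with respect to the total profit equals 1: every state S : N → M that maximizes the total profit (tp(S) ≥ tp(S') for all states S') is a Nash equilibrium, i.e., u_i(S) ≥ u_i(S_{-i}, k) for every player i and every party k ∈ M. -/
/-- The total profit splits into the payoff of player `i` and the total profit without `i`. -/
theorem totalProfit_eq_fvPayoff_add {n m : ℕ} (v : Fin m → Finset (Fin n) → ℝ)
    (S : Fin n → Fin m) (i : Fin n) :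
    totalProfit v S = fvPayoff v S i + ∑ j, v j (Qset S j \ {i}) := by
  rw [totalProfit, fvPayoff, ← sub_eq_iff_eq_add, ← Finset.sum_sub_distrib]
  refine Finset.sum_eq_single (S i) (fun j _ hj => ?_) (by simp)
  rw [Finset.sdiff_eq_self_of_disjoint (by simpa [Qset] using hj.symm), sub_self]

/-- Moving player `i` does not affect the other members of any party. -/
theorem Qset_update_sdiff_singleton {n m : ℕ} (S : Fin n → Fin m) (i : Fin n) (k j : Fin m) :
    Qset (Function.update S i k) j \ {i} = Qset S j \ {i} := by
  ext a
  by_cases ha : a = i <;> simp [Qset, ha]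

/-- In every Fair Value game the price of stability with
respect to the total profit is 1: every total-profit-maximizing state is a
Nash equilibrium. -/
theorem fairValue_pos_one {n m : ℕ}
    (v : Fin m → Finset (Fin n) → ℝ)
    (hzero : ∀ j, v j ∅ = 0)
    (hmono : ∀ j (I J : Finset (Fin n)), I ⊆ J → v j I ≤ v j J)
    (hsub : ∀ j (I J : Finset (Fin n)), I ⊆ J → ∀ i ∉ J,
      v j (insert i I) - v j I ≥ v j (insert i J) - v j J)
    (S : Fin n → Fin m)
    (hopt : ∀ S' : Fin n → Fin m, totalProfit v S ≥ totalProfit v S') :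
    ∀ (i : Fin n) (k : Fin m),
      fvPayoff v S i ≥ fvPayoff v (Function.update S i k) i := by
  intro i k
  have h := hopt (Function.update S i k)
  rw [totalProfit_eq_fvPayoff_add v S i, totalProfit_eq_fvPayoff_add v _ i] at h
  simp only [Qset_update_sdiff_singleton] at h
  linarith
end

section
/- In every Labor Union game, the price of anarchy with respect to the total profit is at most 2: if a state (s,π) is a Nash equilibrium, i.e., no single move of any player strictly increases that player's payoff, then 2·tp(s,π) ≥ tp(s',π') for every state (s',π'); in particular 2·tp(s,π) ≥ OPT. -/
/-- `P_j`: the set of players affiliated with party `j` (strategy `⊥` is `none`). -/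
def luP {n m : ℕ} (s : Fin n → Option (Fin m)) (j : Fin m) : Finset (Fin n) :=
  Finset.univ.filter fun i => s i = some j

/-- `P_j(i)`: the players of party `j` that arrived before `i`. -/
def luPred {n m : ℕ} (s : Fin n → Option (Fin m)) (π : Fin n → ℕ)
    (j : Fin m) (i : Fin n) : Finset (Fin n) :=
  Finset.univ.filter fun i' => s i' = some j ∧ π i' < π i

/-- Labor Union payoff: `u_i(s,π) = 0` if `s i = ⊥`, and
`u_i(s,π) = v_j(P_j(i) ∪ {i}) − v_j(P_j(i))` if `s i = j`. -/
def luPayoff {n m : ℕ} (v : Fin m → Finset (Fin n) → ℝ)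
    (s : Fin n → Option (Fin m)) (π : Fin n → ℕ) (i : Fin n) : ℝ :=
  match s i with
  | none => 0
  | some j => v j (luPred s π j i ∪ {i}) - v j (luPred s π j i)

/-- Total profit of a state: `tp(s,π) = ∑_{j∈M} v_j(P_j)`. -/
def luTp {n m : ℕ} (v : Fin m → Finset (Fin n) → ℝ)
    (s : Fin n → Option (Fin m)) : ℝ :=
  ∑ j, v j (luP s j)

/-- A single move of player `i` to target `k ∈ M ∪ {⊥}` transforms `(s,π)` into
`(s',π')`: `i`'s strategy becomes `k`, everyone else is unchanged, and `i` is
appended last (`π' i > π i'` for all `i' ≠ i`). -/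
def LUMove {n m : ℕ} (i : Fin n) (k : Option (Fin m))
    (s : Fin n → Option (Fin m)) (π : Fin n → ℕ)
    (s' : Fin n → Option (Fin m)) (π' : Fin n → ℕ) : Prop :=
  s' i = k ∧ (∀ i', i' ≠ i → s' i' = s i' ∧ π' i' = π i') ∧
    (∀ i', i' ≠ i → π i' < π' i)

/-- Marginal contributions in order of increasing `π` telescope to the value of the whole set. -/
theorem sum_marginal_of_injective {α : Type*} [DecidableEq α] (f : Finset α → ℝ) (hf : f ∅ = 0)
    {π : α → ℕ} (hπ : Function.Injective π) (P : Finset α) :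
    ∑ i ∈ P, (f (insert i (P.filter fun i' => π i' < π i)) -
      f (P.filter fun i' => π i' < π i)) = f P := by
  induction P using Finset.induction_on_max_value π with
  | empty => simp [hf]
  | insert a P ha hmax ih =>
    have hlt : ∀ x ∈ P, π x < π a := fun x hx =>
      lt_of_le_of_ne (hmax x hx) fun h => ha (hπ h ▸ hx)
    have hlast : (insert a P).filter (fun i' => π i' < π a) = P := by
      rw [Finset.filter_insert, if_neg (lt_irrefl _), Finset.filter_true_of_mem hlt]
    have hprev : ∀ i ∈ P, (insert a P).filter (fun i' => π i' < π i) =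
        P.filter fun i' => π i' < π i := fun i hi => by
      rw [Finset.filter_insert, if_neg (hlt i hi).le.not_gt]
    rw [Finset.sum_insert ha, hlast,
      Finset.sum_congr rfl fun i hi => by rw [hprev i hi], ih]
    ring

/-- A non-decreasing function with diminishing marginals gains at most the sum of the individual
marginals when a set is added. -/
theorem sub_le_sum_marginal {α : Type*} [DecidableEq α] (f : Finset α → ℝ)
    (hmono : ∀ I J : Finset α, I ⊆ J → f I ≤ f J)
    (hsub : ∀ I J : Finset α, I ⊆ J → ∀ i ∉ J, f (insert i I) - f I ≥ f (insert i J) - f J)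
    (A B : Finset α) : f (A ∪ B) - f A ≤ ∑ i ∈ B, (f (insert i A) - f A) := by
  induction B using Finset.induction_on with
  | empty => simp
  | insert a B ha ih =>
    rw [Finset.sum_insert ha, Finset.union_insert]
    by_cases h : a ∈ A ∪ B
    · rw [Finset.insert_eq_of_mem h]
      linarith [hmono A (insert a A) (Finset.subset_insert _ _)]
    · linarith [hsub A (A ∪ B) Finset.subset_union_left a h]

/-- The payoff of a player of party `j`, with `P_j(i)` written as a subset of `P_j`. -/
theorem luPayoff_eq_of_mem_luP {n m : ℕ} (v : Fin m → Finset (Fin n) → ℝ)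
    (s : Fin n → Option (Fin m)) (π : Fin n → ℕ) {i : Fin n} {j : Fin m} (hi : i ∈ luP s j) :
    luPayoff v s π i = v j (insert i ((luP s j).filter fun i' => π i' < π i)) -
      v j ((luP s j).filter fun i' => π i' < π i) := by
  have hs : s i = some j := by simpa [luP] using hi
  simp only [luPayoff, hs, luPred, luP, Finset.filter_filter, Finset.union_singleton]

/-- A sum over all players splits into the parties and the unaffiliated players. -/
theorem sum_eq_sum_luP_add {n m : ℕ} (s : Fin n → Option (Fin m)) (g : Fin n → ℝ) :
    ∑ i, g i = ∑ j, ∑ i ∈ luP s j, g i + ∑ i with s i = none, g i := by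
  rw [← Finset.sum_fiberwise Finset.univ s g, Fintype.sum_option, add_comm]
  rfl

theorem sum_luPayoff {n m : ℕ} (v : Fin m → Finset (Fin n) → ℝ) (hzero : ∀ j, v j ∅ = 0)
    (s : Fin n → Option (Fin m)) {π : Fin n → ℕ} (hπ : Function.Injective π) :
    ∑ i, luPayoff v s π i = luTp v s := by
  have hnone : ∑ i with s i = none, luPayoff v s π i = 0 :=
    Finset.sum_eq_zero fun i hi => by simp [luPayoff, (Finset.mem_filter.1 hi).2]
  rw [sum_eq_sum_luP_add s, hnone, add_zero, luTp]
  refine Finset.sum_congr rfl fun j _ => ?_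
  rw [← sum_marginal_of_injective (v j) (hzero j) hπ (luP s j)]
  exact Finset.sum_congr rfl fun i hi => luPayoff_eq_of_mem_luP v s π hi

theorem luPayoff_nonneg {n m : ℕ} (v : Fin m → Finset (Fin n) → ℝ)
    (hmono : ∀ j (I J : Finset (Fin n)), I ⊆ J → v j I ≤ v j J)
    (s : Fin n → Option (Fin m)) (π : Fin n → ℕ) (i : Fin n) : 0 ≤ luPayoff v s π i := by
  unfold luPayoff
  split
  · exact le_rfl
  · exact sub_nonneg.2 (hmono _ _ _ Finset.subset_union_left)

/-- Player `i` has a move to party `k`, with payoff his marginal contribution to the other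
members of `k`. -/
theorem exists_luMove_luPayoff_eq {n m : ℕ} (v : Fin m → Finset (Fin n) → ℝ)
    (s : Fin n → Option (Fin m)) (π : Fin n → ℕ) (i : Fin n) (k : Fin m) :
    ∃ s' π', LUMove i (some k) s π s' π' ∧ luPayoff v s' π' i =
      v k (insert i ((luP s k).erase i)) - v k ((luP s k).erase i) := by
  have hlt : ∀ x, π x < Finset.univ.sup π + 1 := fun x =>
    Nat.lt_succ_of_le (Finset.le_sup (Finset.mem_univ x))
  refine ⟨Function.update s i (some k), Function.update π i (Finset.univ.sup π + 1),
    ⟨by simp, fun x hx => by simp [hx], fun x _ => by simpa using hlt x⟩, ?_⟩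
  have hpred : luPred (Function.update s i (some k))
      (Function.update π i (Finset.univ.sup π + 1)) k i = (luP s k).erase i := by
    ext x
    by_cases hx : x = i
    · subst hx
      simp only [luPred, Finset.mem_filter, lt_irrefl, and_false, Finset.mem_erase, ne_eq,
        not_true_eq_false, false_and]
    · simpa [luPred, luP, hx] using fun _ => hlt x
  simp only [luPayoff, Function.update_self, hpred, Finset.union_singleton]

/-- In every Labor Union game the price of anarchy with
respect to the total profit is at most 2: if no single move of any player
strictly increases that player's payoff, then `2·tp(s,π) ≥ tp(s',π')` for every
state `(s',π')`; in particular `2·tp(s,π) ≥ OPT`. -/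
theorem laborUnion_poa_two {n m : ℕ}
    (v : Fin m → Finset (Fin n) → ℝ)
    (hzero : ∀ j, v j ∅ = 0)
    (hmono : ∀ j (I J : Finset (Fin n)), I ⊆ J → v j I ≤ v j J)
    (hsub : ∀ j (I J : Finset (Fin n)), I ⊆ J → ∀ i ∉ J,
      v j (insert i I) - v j I ≥ v j (insert i J) - v j J)
    (s : Fin n → Option (Fin m)) (π : Fin n → ℕ) (hπ : Function.Injective π)
    (hNE : ∀ (i : Fin n) (k : Option (Fin m))
      (s' : Fin n → Option (Fin m)) (π' : Fin n → ℕ),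
      LUMove i k s π s' π' → luPayoff v s' π' i ≤ luPayoff v s π i) :
    (∀ (s' : Fin n → Option (Fin m)) (π' : Fin n → ℕ), Function.Injective π' →
      luTp v s' ≤ 2 * luTp v s) ∧
    Finset.univ.sup' Finset.univ_nonempty (luTp v) ≤ 2 * luTp v s := by
  have hdev : ∀ i k, v k (insert i (luP s k)) - v k (luP s k) ≤ luPayoff v s π i := by
    intro i k
    obtain ⟨s', π', hmove, hpay⟩ := exists_luMove_luPayoff_eq v s π i k
    by_cases hi : i ∈ luP s k
    · simpa [hi] using luPayoff_nonneg v hmono s π i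
    · rw [Finset.erase_eq_of_notMem hi] at hpay
      exact hpay ▸ hNE i _ s' π' hmove
  have hbound : ∀ s', luTp v s' ≤ 2 * luTp v s := by
    intro s'
    have hparty : ∀ k, v k (luP s' k) - v k (luP s k) ≤
        ∑ i ∈ luP s' k, luPayoff v s π i := fun k =>
      calc v k (luP s' k) - v k (luP s k)
          ≤ v k (luP s k ∪ luP s' k) - v k (luP s k) :=
            sub_le_sub_right (hmono k _ _ Finset.subset_union_right) _
        _ ≤ ∑ i ∈ luP s' k, (v k (insert i (luP s k)) - v k (luP s k)) :=
            sub_le_sum_marginal (v k) (hmono k) (hsub k) _ _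
        _ ≤ ∑ i ∈ luP s' k, luPayoff v s π i := Finset.sum_le_sum fun i _ => hdev i k
    have hsum : luTp v s' - luTp v s ≤ ∑ k, ∑ i ∈ luP s' k, luPayoff v s π i := by
      rw [luTp, luTp, ← Finset.sum_sub_distrib]
      exact Finset.sum_le_sum fun k _ => hparty k
    have hnone : 0 ≤ ∑ i with s' i = none, luPayoff v s π i :=
      Finset.sum_nonneg fun i _ => luPayoff_nonneg v hmono s π i
    linarith [sum_luPayoff v hzero s hπ, sum_eq_sum_luP_add s' (luPayoff v s π)]
  exact ⟨fun s' _ _ => hbound s', Finset.sup'_le _ _ fun s' _ => hbound s'⟩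
end
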